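/- Assume that (Z,d_Z,ν_Z) is Ahlfors Q_Z-regular and (W,d_W,ν_W) is Ahlfors Q_W-regular with Q_Z > 0, Q_W > 0, and let θ₁ > 0, θ₂ > 0, s > 0, s′ > 0 and p ≥ 1 be constants such that Q_Z ≥ θ₁ Q_W and s′ ≤ θ₂ s + (θ₂ Q_W − Q_Z)/p. Suppose f : (Z,d_Z) → (W,d_W) is a locally (θ₁,θ₂,r)-biHölder continuous homeomorphism with 0 < r < 2·diam Z. Then there is a constant C > 0, depending only on the data, such that for every measurable function u : W → ℝ with ‖u‖_{B^s_{p,p}(W)} < ∞, the composition u∘f satisfies ‖u∘f‖_{B^{s′}_{p,p}(Z)} ≤ C ‖u‖_{B^s_{p,p}(W)}; in particular f induces a bounded embedding f_# : B^s_{p,p}(W) → B^{s′}_{p,p}(Z) via composition. -/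

import Mathlib

open Metric Set MeasureTheory ENNReal

/-- `(Z, d_Z, ν)` is Ahlfors `Q`-regular: there is `C ≥ 1` with
`C⁻¹ r^Q ≤ ν(B(z, r)) ≤ C r^Q` for all `z ∈ Z` and `0 < r < 2 ⬝ diam Z`. -/
def AhlforsRegular {Z : Type*} [MetricSpace Z] [MeasurableSpace Z]
    (ν : Measure Z) (Q : ℝ) : Prop :=
  ∃ C : ℝ, 1 ≤ C ∧ ∀ (z : Z) (r : ℝ), 0 < r →
    ENNReal.ofReal r < 2 * EMetric.diam (Set.univ : Set Z) →
      ENNReal.ofReal (C⁻¹ * r ^ Q) ≤ ν (ball z r) ∧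
      ν (ball z r) ≤ ENNReal.ofReal (C * r ^ Q)

/-- The `p`-th power of the homogeneous Besov seminorm:
`∫_Z ∫_Z |u(x) − u(y)|^p / (d(x,y)^{sp} ν(B(x, d(x,y)))) dν(y) dν(x)`. -/
noncomputable def besovDouble {Z : Type*} [MetricSpace Z] [MeasurableSpace Z]
    (ν : Measure Z) (s p : ℝ) (u : Z → ℝ) : ℝ≥0∞ :=
  ∫⁻ x, ∫⁻ y, ENNReal.ofReal (|u x - u y| ^ p) /
      (ENNReal.ofReal (dist x y ^ (s * p)) * ν (ball x (dist x y))) ∂ν ∂ν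

/-- The Besov norm `‖u‖_{B^s_{p,p}} = ‖u‖_{L^p} + ‖u‖_{Ḃ^s_{p,p}}`. -/
noncomputable def besovNorm {Z : Type*} [MetricSpace Z] [MeasurableSpace Z]
    (ν : Measure Z) (s p : ℝ) (u : Z → ℝ) : ℝ≥0∞ :=
  eLpNorm u (ENNReal.ofReal p) ν + besovDouble ν s p u ^ (1 / p)

/-- The upper bound in Ahlfors regularity extends to all radii. -/
theorem measure_ball_le_of_ahlfors {Z : Type*} [MetricSpace Z] [MeasurableSpace Z]
    {ν : Measure Z} {Q C : ℝ} (hQ : 0 < Q) (hC : 1 ≤ C)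
    (hdiam : 0 < ediam (univ : Set Z))
    (h : ∀ (z : Z) (r : ℝ), 0 < r → ENNReal.ofReal r < 2 * ediam (univ : Set Z) →
      ν (ball z r) ≤ ENNReal.ofReal (C * r ^ Q))
    (z : Z) {r : ℝ} (hr : 0 < r) : ν (ball z r) ≤ ENNReal.ofReal (C * r ^ Q) := by
  by_cases hlt : ENNReal.ofReal r < 2 * ediam (univ : Set Z)
  · exact h z r hr hlt
  have hle : 2 * ediam (univ : Set Z) ≤ ENNReal.ofReal r := not_lt.1 hlt
  have hfin : ediam (univ : Set Z) ≠ ⊤ := by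
    intro htop
    rw [htop, ENNReal.mul_top (by norm_num)] at hle
    exact ENNReal.ofReal_ne_top (top_le_iff.1 hle)
  set D := (ediam (univ : Set Z)).toReal
  have hDpos : 0 < D := ENNReal.toReal_pos hdiam.ne' hfin
  have hDe : ediam (univ : Set Z) = ENNReal.ofReal D := (ENNReal.ofReal_toReal hfin).symm
  have h2 : (2 : ℝ≥0∞) * ediam (univ : Set Z) = ENNReal.ofReal (2 * D) := by
    rw [hDe, ENNReal.ofReal_mul (by norm_num)]; norm_num
  rw [h2, ENNReal.ofReal_le_ofReal_iff hr.le] at hle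
  have hsub : ball z r ⊆ ball z (3 / 2 * D) := by
    intro y _
    rw [mem_ball]
    have : edist y z ≤ ENNReal.ofReal D := hDe ▸ edist_le_ediam_of_mem (mem_univ _) (mem_univ _)
    rw [edist_dist, ENNReal.ofReal_le_ofReal_iff hDpos.le] at this
    linarith
  refine (measure_mono hsub).trans ((h z (3 / 2 * D) (by positivity) ?_).trans ?_)
  · rw [h2]
    exact (ENNReal.ofReal_lt_ofReal_iff (by positivity)).2 (by linarith)
  · apply ENNReal.ofReal_le_ofReal
    gcongr
    linarith

theorem sigmaFinite_of_measure_ball_ne_top {Z : Type*} [MetricSpace Z] [MeasurableSpace Z]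
    {ν : Measure Z} (h : ∀ (z : Z) (r : ℝ), 0 < r → ν (ball z r) ≠ ⊤) : SigmaFinite ν := by
  rcases isEmpty_or_nonempty Z with hZ | ⟨⟨z⟩⟩
  · rw [Measure.eq_zero_of_isEmpty ν]
    infer_instance
  · refine ⟨⟨⟨fun n => ball z (n + 1 : ℝ), fun _ => trivial,
      fun n => (h z _ (by positivity)).lt_top, ?_⟩⟩⟩
    refine eq_univ_of_forall fun y => ?_
    obtain ⟨n, hn⟩ := exists_nat_gt (dist y z)
    exact mem_iUnion.2 ⟨n, by rw [mem_ball]; linarith⟩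

theorem secondCountableTopology_of_measure_closedBall_pos {Z : Type*} [MetricSpace Z]
    [MeasurableSpace Z] [BorelSpace Z] {ν : Measure Z} [SigmaFinite ν]
    (h : ∀ (z : Z) (r : ℝ), 0 < r → 0 < ν (closedBall z r)) : SecondCountableTopology Z := by
  refine secondCountable_of_almost_dense_set fun ε hε => ?_
  obtain ⟨t, -, hdisj, hcov⟩ := Vitali.exists_disjoint_subfamily_covering_enlargement_closedBall
    (univ : Set Z) id (fun _ => ε / 5) (ε / 5) (fun _ _ => le_rfl) 5 (by norm_num)
  refine ⟨t, ?_, fun x => ?_⟩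
  · have hc := Measure.countable_meas_pos_of_disjoint_iUnion (μ := ν)
      (As := fun i : t => closedBall (i : Z) (ε / 5)) (fun _ => measurableSet_closedBall)
      (fun i j hij => hdisj i.2 j.2 (fun h => hij (Subtype.ext h)))
    have huniv : {i : t | 0 < ν (closedBall (i : Z) (ε / 5))} = univ :=
      eq_univ_of_forall fun i => h i _ (by positivity)
    rw [huniv] at hc
    exact countable_coe_iff.1 (countable_univ_iff.1 hc)
  · obtain ⟨b, hb, hsub⟩ := hcov x (mem_univ _)
    have := hsub (mem_closedBall_self (by positivity))
    rw [mem_closedBall] at this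
    exact ⟨b, hb, by simpa [mul_div_cancel₀] using this.trans (by linarith : 5 * (ε / 5) ≤ ε)⟩

/-- If `f` satisfies a lower Hölder bound of exponent `θ` on a set `E`, the measure `μ` has
growth of order `P` with `θ * Q ≤ P` and small balls have `ν`-measure at least of order `Q`,
then `μ E` is controlled by `ν (f '' E)`. -/
theorem measure_le_mul_measure_image_of_holder_lower {Z W : Type*}
    [MetricSpace Z] [MeasurableSpace Z] [MetricSpace W] [MeasurableSpace W] [BorelSpace W]
    [SecondCountableTopology W] {μ : Measure Z} {ν : Measure W} [ν.OuterRegular]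
    {P Q θ A B L ρ₀ : ℝ} (hθ : 0 < θ) (hPQ : θ * Q ≤ P)
    (hA : 0 < A) (hB : 0 < B) (hL : 0 < L) (hρ₀ : 0 < ρ₀) (hρ₀' : ρ₀ ≤ 1)
    (hμ : ∀ (z : Z) (r : ℝ), 0 < r → μ (ball z r) ≤ ENNReal.ofReal (A * r ^ P))
    (hν : ∀ (w : W) (r : ℝ), 0 < r → r ≤ ρ₀ → ENNReal.ofReal (B⁻¹ * r ^ Q) ≤ ν (ball w r))
    (f : Z → W) (E : Set Z)
    (hf : ∀ x ∈ E, ∀ y ∈ E, L⁻¹ * dist x y ^ θ ≤ dist (f x) (f y)) :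
    μ E ≤ ENNReal.ofReal (A * 2 ^ P * (5 * L) ^ (P / θ) * B) * ν (f '' E) := by
  set M := A * 2 ^ P * (5 * L) ^ (P / θ) * B with hM
  have hMpos : 0 < M := by positivity
  suffices hU : ∀ U : Set W, f '' E ⊆ U → IsOpen U → (ENNReal.ofReal M)⁻¹ * μ E ≤ ν U by
    rw [← ENNReal.inv_mul_le_iff (by simpa using hMpos) ENNReal.ofReal_ne_top,
      measure_eq_iInf_isOpen (f '' E) ν]
    exact le_iInf fun U => le_iInf fun h => le_iInf fun h' => hU U h h'
  intro U hEU hUo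
  rw [ENNReal.inv_mul_le_iff (by simpa using hMpos) ENNReal.ofReal_ne_top]
  have hrad : ∀ x : Z, ∃ ρ : ℝ, x ∈ E → 0 < ρ ∧ ρ ≤ ρ₀ ∧ closedBall (f x) ρ ⊆ U := by
    intro x
    by_cases hx : x ∈ E
    · obtain ⟨ε, hε, hsub⟩ := Metric.nhds_basis_closedBall.mem_iff.1
        (hUo.mem_nhds (hEU (mem_image_of_mem f hx)))
      exact ⟨min ε ρ₀, fun _ => ⟨lt_min hε hρ₀, min_le_right _ _,
        (closedBall_subset_closedBall (min_le_left _ _)).trans hsub⟩⟩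
    · exact ⟨0, fun h => absurd h hx⟩
  choose ρ hρ using hrad
  obtain ⟨t, htE, hdisj, hcov⟩ := Vitali.exists_disjoint_subfamily_covering_enlargement_closedBall
    E f ρ ρ₀ (fun x hx => (hρ x hx).2.1) 5 (by norm_num)
  have htc : t.Countable := hdisj.countable_of_nonempty_interior fun x hx =>
    ⟨f x, ball_subset_interior_closedBall (mem_ball_self (hρ x (htE hx)).1)⟩
  set R : Z → ℝ := fun x => 2 * (5 * L * ρ x) ^ (1 / θ) with hR
  have hsub : E ⊆ ⋃ b ∈ t, ball b (R b) := by
    intro x hx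
    obtain ⟨b, hb, hxb⟩ := hcov x hx
    have hρb := (hρ b (htE hb)).1
    have h1 := hxb (mem_closedBall_self (hρ x hx).1.le)
    rw [mem_closedBall] at h1
    have h2 := (hf x hx b (htE hb)).trans h1
    rw [inv_mul_le_iff₀ hL] at h2
    refine mem_iUnion₂.2 ⟨b, hb, ?_⟩
    rw [mem_ball]
    have h3 : dist x b ≤ (5 * L * ρ b) ^ (1 / θ) := by
      rw [one_div, Real.le_rpow_inv_iff_of_pos dist_nonneg (by positivity) hθ]
      linarith
    have h4 : 0 < (5 * L * ρ b) ^ (1 / θ) := by positivity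
    simp only [hR]
    linarith
  have hball : ∀ b ∈ t, μ (ball b (R b)) ≤ ENNReal.ofReal M * ν (closedBall (f b) (ρ b)) := by
    intro b hb
    obtain ⟨hρb, hρb', -⟩ := hρ b (htE hb)
    have h1 : A * R b ^ P ≤ M * (B⁻¹ * ρ b ^ Q) := by
      have e1 : R b ^ P = 2 ^ P * ((5 * L) ^ (P / θ) * ρ b ^ (P / θ)) := by
        simp only [hR]
        rw [Real.mul_rpow (by norm_num) (by positivity), ← Real.rpow_mul (by positivity),
          Real.mul_rpow (by positivity) hρb.le, one_div_mul_eq_div]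
      have e2 : ρ b ^ (P / θ) ≤ ρ b ^ Q :=
        Real.rpow_le_rpow_of_exponent_ge hρb (hρb'.trans hρ₀')
          ((le_div_iff₀ hθ).2 (by linarith))
      have e3 : M * (B⁻¹ * ρ b ^ Q) = A * (2 ^ P * ((5 * L) ^ (P / θ) * ρ b ^ Q)) := by
        rw [hM]; field_simp
      rw [e1, e3]
      gcongr
    calc μ (ball b (R b)) ≤ ENNReal.ofReal (A * R b ^ P) :=
          hμ b _ (by simp only [hR]; positivity)
      _ ≤ ENNReal.ofReal (M * (B⁻¹ * ρ b ^ Q)) := ENNReal.ofReal_le_ofReal h1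
      _ = ENNReal.ofReal M * ENNReal.ofReal (B⁻¹ * ρ b ^ Q) := ENNReal.ofReal_mul hMpos.le
      _ ≤ ENNReal.ofReal M * ν (closedBall (f b) (ρ b)) := by
          gcongr
          exact (hν _ _ hρb hρb').trans (measure_mono ball_subset_closedBall)
  calc μ E ≤ μ (⋃ b ∈ t, ball b (R b)) := measure_mono hsub
    _ ≤ ∑' b : t, μ (ball (b : Z) (R b)) := measure_biUnion_le μ htc _
    _ ≤ ∑' b : t, ENNReal.ofReal M * ν (closedBall (f b) (ρ b)) :=
        ENNReal.tsum_le_tsum fun b => hball b b.2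
    _ = ENNReal.ofReal M * ν (⋃ b ∈ t, closedBall (f b) (ρ b)) := by
        rw [ENNReal.tsum_mul_left, measure_biUnion htc hdisj fun _ _ => measurableSet_closedBall]
    _ ≤ ENNReal.ofReal M * ν U := by
        gcongr
        exact iUnion₂_subset fun b hb => (hρ b (htE hb)).2.2

/-- A local comparison of measures along a homeomorphism globalizes with the same constant. -/
theorem map_le_smul_of_local {Z W : Type*}
    [MetricSpace Z] [MeasurableSpace Z] [BorelSpace Z] [SecondCountableTopology Z]
    [MetricSpace W] [MeasurableSpace W] [BorelSpace W]
    {μ : Measure Z} {ν : Measure W} (f : Z ≃ₜ W) {M : ℝ≥0∞} {ε : ℝ} (hε : 0 < ε)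
    (h : ∀ (z : Z) (E : Set Z), E ⊆ ball z ε → μ E ≤ M * ν (f '' E)) :
    μ.map f ≤ M • ν := by
  rcases isEmpty_or_nonempty Z with hZ | hZ
  · rw [Measure.eq_zero_of_isEmpty μ, Measure.map_zero]
    exact Measure.zero_le _
  set D : ℕ → Set Z := disjointed fun n => ball (TopologicalSpace.denseSeq Z n) ε with hD
  have hDm : ∀ n, MeasurableSet (D n) := MeasurableSet.disjointed fun _ => measurableSet_ball
  have hDd : Pairwise (Function.onFun Disjoint D) := disjoint_disjointed _
  have hDu : ⋃ n, D n = univ := by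
    rw [hD, iUnion_disjointed]
    refine eq_univ_of_forall fun x => ?_
    obtain ⟨n, hn⟩ :=
      (TopologicalSpace.denseRange_denseSeq Z).exists_mem_open isOpen_ball ⟨x, mem_ball_self hε⟩
    exact mem_iUnion.2 ⟨n, by rwa [mem_ball_comm] at hn⟩
  refine Measure.le_iff.2 fun A hA => ?_
  rw [Measure.map_apply f.continuous.measurable hA, Measure.smul_apply, smul_eq_mul]
  have hfA := f.continuous.measurable hA
  have himage : ∀ n, MeasurableSet (f '' (f ⁻¹' A ∩ D n)) := fun n =>
    f.toMeasurableEquiv.measurableSet_image.2 (hfA.inter (hDm n))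
  calc μ (f ⁻¹' A) = ∑' n, μ (f ⁻¹' A ∩ D n) := by
        rw [← measure_iUnion (fun i j hij => (hDd hij).mono inter_subset_right inter_subset_right)
          (fun n => hfA.inter (hDm n)), ← inter_iUnion, hDu, inter_univ]
    _ ≤ ∑' n, M * ν (f '' (f ⁻¹' A ∩ D n)) := ENNReal.tsum_le_tsum fun n =>
        h _ _ (inter_subset_right.trans (disjointed_subset _ n))
    _ = M * ν A := by
        rw [ENNReal.tsum_mul_left, ← measure_iUnion (fun i j hij => ?_) himage, ← image_iUnion,
          ← inter_iUnion, hDu, inter_univ, image_preimage_eq _ f.surjective]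
        exact (disjoint_image_iff f.injective).2
          ((hDd hij).mono inter_subset_right inter_subset_right)

/-- The kernel `d(x, y)^{-a}` cut off to the region `r ≤ d(x, y)`. -/
noncomputable def farKernel {Z : Type*} [MetricSpace Z] (r a : ℝ) (x y : Z) : ℝ≥0∞ :=
  if r ≤ dist x y then ENNReal.ofReal (dist x y ^ (-a)) else 0

theorem farKernel_comm {Z : Type*} [MetricSpace Z] (r a : ℝ) (x y : Z) :
    farKernel r a x y = farKernel r a y x := by
  simp only [farKernel, dist_comm]

theorem measurable_uncurry_farKernel {Z : Type*} [MetricSpace Z] [MeasurableSpace Z]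
    [BorelSpace Z] [SecondCountableTopology Z] (r a : ℝ) :
    Measurable (Function.uncurry (farKernel r a : Z → Z → ℝ≥0∞)) := by
  have hd : Measurable fun q : Z × Z => dist q.1 q.2 := measurable_dist
  exact Measurable.ite (measurableSet_le measurable_const hd)
    (hd.pow_const _).ennreal_ofReal measurable_const

/-- Under the growth bound `ν(B(z, t)) ≤ C t^Q`, the cut-off kernel of exponent `β + Q` with
`β > 0` has uniformly bounded integrals. -/
theorem exists_lintegral_farKernel_le {Z : Type*} [MetricSpace Z] [MeasurableSpace Z]
    [BorelSpace Z] {ν : Measure Z} {Q C r β : ℝ} (hQ : 0 < Q) (hC : 0 < C) (hr : 0 < r)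
    (hβ : 0 < β)
    (h : ∀ (z : Z) (t : ℝ), 0 < t → ν (ball z t) ≤ ENNReal.ofReal (C * t ^ Q)) :
    ∃ K : ℝ, 0 < K ∧ ∀ x : Z, ∫⁻ y, farKernel r (β + Q) x y ∂ν ≤ ENNReal.ofReal K := by
  set q : ℝ := 2 ^ (-β) with hq
  have hq0 : 0 < q := by positivity
  have hq1 : q < 1 := Real.rpow_lt_one_of_one_lt_of_neg (by norm_num) (by linarith)
  set A : ℝ := C * 2 ^ Q * r ^ (-β) with hA
  have hApos : 0 < A := by positivity
  have hsum : Summable fun n : ℕ => A * q ^ n :=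
    (summable_geometric_of_lt_one hq0.le hq1).mul_left _
  refine ⟨∑' n : ℕ, A * q ^ n, hsum.tsum_pos (fun n => by positivity) 0 (by positivity),
    fun x => ?_⟩
  have hpt : ∀ y, farKernel r (β + Q) x y ≤ ∑' n : ℕ, (ball x (2 ^ (n + 1) * r)).indicator
      (fun _ => ENNReal.ofReal ((2 ^ n * r) ^ (-(β + Q)))) y := by
    intro y
    unfold farKernel
    split_ifs with hxy
    · obtain ⟨n, hn, hn'⟩ := exists_nat_pow_near ((one_le_div hr).2 hxy) (one_lt_two (α := ℝ))
      rw [le_div_iff₀ hr] at hn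
      rw [div_lt_iff₀ hr] at hn'
      refine le_trans ?_ (ENNReal.le_tsum n)
      rw [indicator_of_mem (by rwa [mem_ball, dist_comm])]
      exact ENNReal.ofReal_le_ofReal
        (Real.rpow_le_rpow_of_nonpos (by positivity) hn (by linarith))
    · exact zero_le
  calc ∫⁻ y, farKernel r (β + Q) x y ∂ν
      ≤ ∫⁻ y, ∑' n : ℕ, (ball x (2 ^ (n + 1) * r)).indicator
        (fun _ => ENNReal.ofReal ((2 ^ n * r) ^ (-(β + Q)))) y ∂ν := lintegral_mono hpt
    _ = ∑' n : ℕ, ENNReal.ofReal ((2 ^ n * r) ^ (-(β + Q))) * ν (ball x (2 ^ (n + 1) * r)) := by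
        rw [lintegral_tsum fun n =>
          (measurable_const.indicator measurableSet_ball).aemeasurable]
        simp_rw [lintegral_indicator_const measurableSet_ball]
    _ ≤ ∑' n : ℕ, ENNReal.ofReal (A * q ^ n) := by
        refine ENNReal.tsum_le_tsum fun n => ?_
        refine (mul_le_mul_right (h x (2 ^ (n + 1) * r) (by positivity)) _).trans ?_
        rw [← ENNReal.ofReal_mul (by positivity)]
        refine ENNReal.ofReal_le_ofReal (le_of_eq ?_)
        have e1 : (2 : ℝ) ^ (n + 1) * r = 2 * (2 ^ n * r) := by ring
        have e2 : q ^ n = (2 ^ n : ℝ) ^ (-β) := by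
          rw [hq, ← Real.rpow_natCast, ← Real.rpow_mul (by norm_num), ← Real.rpow_natCast,
            ← Real.rpow_mul (by norm_num), mul_comm]
        have hpos : (0 : ℝ) < 2 ^ n * r := by positivity
        rw [e1, e2, hA, Real.mul_rpow (by norm_num) hpos.le, neg_add, Real.rpow_add hpos,
          Real.rpow_neg hpos.le Q, Real.mul_rpow (by positivity) hr.le]
        field_simp
    _ = ENNReal.ofReal (∑' n : ℕ, A * q ^ n) :=
        (ENNReal.ofReal_tsum_of_nonneg (fun n => by positivity) hsum).symm

theorem lintegral_comp_le_of_map_le {Z W : Type*} [MeasurableSpace Z] [MeasurableSpace W]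
    {μ : Measure Z} {ν : Measure W} (e : Z ≃ᵐ W) {M : ℝ≥0∞} (h : μ.map e ≤ M • ν)
    (F : W → ℝ≥0∞) : ∫⁻ z, F (e z) ∂μ ≤ M * ∫⁻ w, F w ∂ν := by
  rw [← lintegral_map_equiv F e, ← smul_eq_mul, ← lintegral_smul_measure]
  exact lintegral_mono' h le_rfl

/-- Integrating `(h x + h y) k(x, y)` against a symmetric kernel with bounded integrals. -/
theorem lintegral_lintegral_add_mul_le {Z : Type*} [MeasurableSpace Z] {μ : Measure Z}
    [SFinite μ] {k : Z → Z → ℝ≥0∞} (hk : Measurable (Function.uncurry k))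
    (hsymm : ∀ x y, k x y = k y x) {K : ℝ≥0∞} (hK : ∀ x, ∫⁻ y, k x y ∂μ ≤ K)
    {h : Z → ℝ≥0∞} (hh : Measurable h) :
    ∫⁻ x, ∫⁻ y, (h x + h y) * k x y ∂μ ∂μ ≤ 2 * K * ∫⁻ x, h x ∂μ := by
  have hfst : Measurable (Function.uncurry fun x y => h x * k x y) :=
    (hh.comp measurable_fst).mul hk
  have hsnd : Measurable (Function.uncurry fun x y => h y * k x y) :=
    (hh.comp measurable_snd).mul hk
  have hone : ∫⁻ x, ∫⁻ y, h x * k x y ∂μ ∂μ ≤ K * ∫⁻ x, h x ∂μ := by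
    rw [← lintegral_const_mul K hh]
    refine lintegral_mono fun x => ?_
    rw [lintegral_const_mul _ hk.of_uncurry_left, mul_comm]
    gcongr
    exact hK x
  have hswap : ∫⁻ x, ∫⁻ y, h y * k x y ∂μ ∂μ = ∫⁻ x, ∫⁻ y, h x * k x y ∂μ ∂μ := by
    rw [lintegral_lintegral_swap hsnd.aemeasurable]
    simp_rw [hsymm]
  simp_rw [add_mul]
  simp_rw [lintegral_add_left (hfst.of_uncurry_left)]
  rw [lintegral_add_left hfst.lintegral_prod_right, hswap, ← two_mul, mul_assoc]
  gcongr

theorem ofReal_abs_sub_rpow_le {p : ℝ} (hp : 1 ≤ p) (a b : ℝ) :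
    ENNReal.ofReal (|a - b| ^ p) ≤ ENNReal.ofReal (2 ^ (p - 1)) * (‖a‖ₑ ^ p + ‖b‖ₑ ^ p) := by
  have hp0 : 0 ≤ p := by linarith
  rw [← ENNReal.ofReal_rpow_of_nonneg (abs_nonneg _) hp0, ← Real.enorm_eq_ofReal_abs,
    ← ENNReal.ofReal_rpow_of_pos (by norm_num)]
  refine (ENNReal.rpow_le_rpow enorm_sub_le hp0).trans ?_
  simpa using ENNReal.rpow_add_le_mul_rpow_add_rpow ‖a‖ₑ ‖b‖ₑ hp

theorem eLpNorm_ofReal_eq {W : Type*} [MeasurableSpace W] {ν : Measure W} {p : ℝ} (hp : 1 ≤ p)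
    (u : W → ℝ) :
    eLpNorm u (ENNReal.ofReal p) ν = (∫⁻ w, ‖u w‖ₑ ^ p ∂ν) ^ (1 / p) := by
  have hp0 : 0 < p := by linarith
  rw [eLpNorm_eq_lintegral_rpow_enorm_toReal (by simpa using hp0) ENNReal.ofReal_ne_top,
    ENNReal.toReal_ofReal hp0.le]

/-- A composition estimate at the level of the double integral and of the `L^p` integral gives
the estimate for Besov norms. -/
theorem besovNorm_le_of_lintegral_le {Z W : Type*} [MetricSpace Z] [MeasurableSpace Z]
    [MetricSpace W] [MeasurableSpace W] {μ : Measure Z} {ν : Measure W} {s s' p a b c : ℝ}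
    (hp : 1 ≤ p) (ha : 0 < a) (hb : 0 < b) (hc : 0 < c) {u : W → ℝ} {v : Z → ℝ}
    (hLp : ∫⁻ z, ‖v z‖ₑ ^ p ∂μ ≤ ENNReal.ofReal c * ∫⁻ w, ‖u w‖ₑ ^ p ∂ν)
    (hB : besovDouble μ s' p v ≤ ENNReal.ofReal a * besovDouble ν s p u +
      ENNReal.ofReal b * ∫⁻ w, ‖u w‖ₑ ^ p ∂ν) :
    besovNorm μ s' p v ≤
      ENNReal.ofReal (c ^ (1 / p) + a ^ (1 / p) + b ^ (1 / p)) * besovNorm ν s p u := by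
  have hp0 : 0 < p := by linarith
  have hp1 : 0 ≤ 1 / p := by positivity
  have hp2 : 1 / p ≤ 1 := (div_le_one hp0).2 hp
  unfold besovNorm
  rw [eLpNorm_ofReal_eq hp, eLpNorm_ofReal_eq hp,
    ENNReal.ofReal_add (by positivity) (by positivity),
    ENNReal.ofReal_add (by positivity) (by positivity), ← ENNReal.ofReal_rpow_of_pos ha,
    ← ENNReal.ofReal_rpow_of_pos hb, ← ENNReal.ofReal_rpow_of_pos hc]
  have h1 := ENNReal.rpow_le_rpow hLp hp1
  have h2 := (ENNReal.rpow_le_rpow hB hp1).trans (ENNReal.rpow_add_le_add_rpow _ _ hp1 hp2)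
  simp only [ENNReal.mul_rpow_of_nonneg _ _ hp1] at h1 h2
  generalize (∫⁻ w, ‖u w‖ₑ ^ p ∂ν) ^ (1 / p) = N at *
  generalize besovDouble ν s p u ^ (1 / p) = S at *
  generalize ENNReal.ofReal a ^ (1 / p) = a' at *
  generalize ENNReal.ofReal b ^ (1 / p) = b' at *
  generalize ENNReal.ofReal c ^ (1 / p) = c' at *
  calc _ ≤ c' * N + (a' * S + b' * N) := add_le_add h1 h2
    _ ≤ c' * N + (a' * S + b' * N) + (c' * S + a' * N + b' * S) := le_self_add
    _ = (c' + a' + b') * (N + S) := by ring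

/-- Comparison of the Besov denominators along a Hölder map at distances below `r`. -/
theorem exists_denominator_le {Z W : Type*} [MetricSpace Z] [MeasurableSpace Z]
    [MetricSpace W] [MeasurableSpace W] {μ : Measure Z} {ν : Measure W}
    {P Q A B L θ s s' p r : ℝ} (hA : 0 < A) (hB : 0 < B) (hL : 0 < L) (hr : 0 < r)
    (hQ : 0 < Q) (hs : 0 < s) (hp : 0 < p) (hexp : s' * p + P ≤ θ * (s * p + Q))
    (hμ : ∀ x y : Z, x ≠ y → ENNReal.ofReal (A⁻¹ * dist x y ^ P) ≤ μ (ball x (dist x y)))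
    (hν : ∀ (w : W) (t : ℝ), 0 < t → ν (ball w t) ≤ ENNReal.ofReal (B * t ^ Q))
    {f : Z → W} (hfinj : Function.Injective f)
    (hf : ∀ x y : Z, dist x y < r → dist (f x) (f y) ≤ L * dist x y ^ θ) :
    ∃ K : ℝ, 0 < K ∧ ∀ x y : Z, x ≠ y → dist x y < r →
      ENNReal.ofReal (dist (f x) (f y) ^ (s * p)) * ν (ball (f x) (dist (f x) (f y))) ≤
        ENNReal.ofReal K *
          (ENNReal.ofReal (dist x y ^ (s' * p)) * μ (ball x (dist x y))) := by
  set δ := θ * (s * p + Q) - (s' * p + P) with hδ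
  refine ⟨A * B * L ^ (s * p + Q) * r ^ δ, by positivity, fun x y hxy hlt => ?_⟩
  have hd : 0 < dist x y := dist_pos.2 hxy
  have hd' : 0 < dist (f x) (f y) := dist_pos.2 (hfinj.ne hxy)
  have hexp0 : 0 < s * p + Q := by positivity
  calc _ ≤ ENNReal.ofReal (dist (f x) (f y) ^ (s * p)) *
        ENNReal.ofReal (B * dist (f x) (f y) ^ Q) := by gcongr; exact hν _ _ hd'
    _ = ENNReal.ofReal (B * dist (f x) (f y) ^ (s * p + Q)) := by
        rw [← ENNReal.ofReal_mul (by positivity), Real.rpow_add hd']; congr 1; ring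
    _ ≤ ENNReal.ofReal (A * B * L ^ (s * p + Q) * r ^ δ *
          (dist x y ^ (s' * p) * (A⁻¹ * dist x y ^ P))) := by
        apply ENNReal.ofReal_le_ofReal
        have e1 : dist (f x) (f y) ^ (s * p + Q) ≤
            L ^ (s * p + Q) * dist x y ^ (θ * (s * p + Q)) := by
          rw [Real.rpow_mul hd.le, ← Real.mul_rpow hL.le (by positivity)]
          exact Real.rpow_le_rpow hd'.le (hf x y hlt) hexp0.le
        have e2 : dist x y ^ (θ * (s * p + Q)) ≤
            r ^ δ * (dist x y ^ (s' * p) * dist x y ^ P) := by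
          rw [← Real.rpow_add hd, show θ * (s * p + Q) = δ + (s' * p + P) by rw [hδ]; ring,
            Real.rpow_add hd]
          have hδ0 : 0 ≤ δ := sub_nonneg.2 hexp
          gcongr
        calc _ ≤ B * (L ^ (s * p + Q) * (r ^ δ * (dist x y ^ (s' * p) * dist x y ^ P))) := by
              gcongr
              exact e1.trans (by gcongr)
          _ = _ := by field_simp
    _ = ENNReal.ofReal (A * B * L ^ (s * p + Q) * r ^ δ) * (ENNReal.ofReal (dist x y ^ (s' * p)) *
          ENNReal.ofReal (A⁻¹ * dist x y ^ P)) := by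
        rw [← ENNReal.ofReal_mul (by positivity), ← ENNReal.ofReal_mul (by positivity)]
    _ ≤ _ := by gcongr; exact hμ x y hxy

theorem div_le_mul_div_of_le_mul {a b c K : ℝ≥0∞} (hK : K ≠ 0) (hK' : K ≠ ⊤)
    (h : b ≤ K * c) : a / c ≤ K * (a / b) := by
  calc a / c = K * (a / (K * c)) := by
        rw [div_eq_mul_inv, div_eq_mul_inv, ENNReal.mul_inv (Or.inl hK) (Or.inl hK'),
          mul_left_comm, ← mul_assoc K, ENNReal.mul_inv_cancel hK hK', one_mul]
    _ ≤ K * (a / b) := by gcongr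

/-- Bound of the Besov integrand at distances at least `r`. -/
theorem besov_integrand_far_le {Z : Type*} [MetricSpace Z] [MeasurableSpace Z] {μ : Measure Z}
    {P A s p r : ℝ} (hA : 0 < A) (hr : 0 < r) (hp : 1 ≤ p) (v : Z → ℝ) {x y : Z}
    (hμ : ENNReal.ofReal (A⁻¹ * dist x y ^ P) ≤ μ (ball x (dist x y))) (hxy : r ≤ dist x y) :
    ENNReal.ofReal (|v x - v y| ^ p) /
        (ENNReal.ofReal (dist x y ^ (s * p)) * μ (ball x (dist x y))) ≤
      ENNReal.ofReal (2 ^ (p - 1) * A) *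
        ((‖v x‖ₑ ^ p + ‖v y‖ₑ ^ p) * farKernel r (s * p + P) x y) := by
  have hd : 0 < dist x y := hr.trans_le hxy
  have hden : ENNReal.ofReal (A⁻¹ * dist x y ^ (s * p + P)) ≤
      ENNReal.ofReal (dist x y ^ (s * p)) * μ (ball x (dist x y)) := by
    calc _ = ENNReal.ofReal (dist x y ^ (s * p)) * ENNReal.ofReal (A⁻¹ * dist x y ^ P) := by
          rw [← ENNReal.ofReal_mul (by positivity), Real.rpow_add hd]; congr 1; ring
      _ ≤ _ := by gcongr
  have hinv : (ENNReal.ofReal (A⁻¹ * dist x y ^ (s * p + P)))⁻¹ =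
      ENNReal.ofReal A * ENNReal.ofReal (dist x y ^ (-(s * p + P))) := by
    rw [← ENNReal.ofReal_inv_of_pos (by positivity), ← ENNReal.ofReal_mul hA.le, mul_inv, inv_inv,
      Real.rpow_neg hd.le]
  rw [farKernel, if_pos hxy, div_eq_mul_inv]
  calc _ ≤ (ENNReal.ofReal (2 ^ (p - 1)) * (‖v x‖ₑ ^ p + ‖v y‖ₑ ^ p)) *
        (ENNReal.ofReal A * ENNReal.ofReal (dist x y ^ (-(s * p + P)))) := by
        rw [← hinv]
        gcongr
        exact ofReal_abs_sub_rpow_le hp _ _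
    _ = _ := by rw [ENNReal.ofReal_mul (by positivity)]; ring

theorem ofReal_dist_lt_two_mul_ediam {Z : Type*} [MetricSpace Z] {x y : Z} (hxy : x ≠ y) :
    ENNReal.ofReal (dist x y) < 2 * ediam (univ : Set Z) := by
  rw [← edist_dist]
  have h1 : edist x y ≤ ediam (univ : Set Z) := edist_le_ediam_of_mem (mem_univ _) (mem_univ _)
  calc edist x y < 2 * edist x y := by
        rw [two_mul]
        exact ENNReal.lt_add_right (edist_ne_top _ _) (edist_pos.2 hxy).ne'
    _ ≤ 2 * ediam (univ : Set Z) := by gcongr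

/-- Let `(Z, νZ)` be Ahlfors `Q_Z`-regular and `(W, νW)` be Ahlfors
`Q_W`-regular (`Q_Z, Q_W > 0`), and let `θ₁, θ₂, s, s' > 0`, `p ≥ 1` satisfy
`Q_Z ≥ θ₁ Q_W` and `s' ≤ θ₂ s + (θ₂ Q_W − Q_Z)/p`. If `f : Z → W` is a locally
`(θ₁, θ₂, r)`-biHölder continuous homeomorphism with `0 < r < 2 ⬝ diam Z`, then there is a
constant `C > 0` such that `‖u ∘ f‖_{B^{s'}_{p,p}(Z)} ≤ C ‖u‖_{B^s_{p,p}(W)}` for every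
measurable `u : W → ℝ` with finite Besov norm; i.e. `f` induces a bounded embedding
`f_# : B^s_{p,p}(W) → B^{s'}_{p,p}(Z)` via composition. -/
theorem besov_embedding_of_locally_biHolder
    {Z W : Type*} [MetricSpace Z] [MeasurableSpace Z] [BorelSpace Z]
    [MetricSpace W] [MeasurableSpace W] [BorelSpace W]
    (νZ : Measure Z) (νW : Measure W)
    (QZ QW : ℝ) (hQZ : 0 < QZ) (hQW : 0 < QW)
    (hAZ : AhlforsRegular νZ QZ) (hAW : AhlforsRegular νW QW)
    (θ₁ θ₂ s s' p : ℝ) (hθ₁ : 0 < θ₁) (hθ₂ : 0 < θ₂)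
    (hs : 0 < s) (hs' : 0 < s') (hp : 1 ≤ p)
    (hQ : θ₁ * QW ≤ QZ) (hss' : s' ≤ θ₂ * s + (θ₂ * QW - QZ) / p)
    (r : ℝ) (hr : 0 < r) (hr' : ENNReal.ofReal r < 2 * EMetric.diam (Set.univ : Set Z))
    (f : Z ≃ₜ W) (Cf : ℝ) (hCf : 1 ≤ Cf)
    (hf : ∀ x y : Z, dist x y < r →
      Cf⁻¹ * dist x y ^ θ₁ ≤ dist (f x) (f y) ∧ dist (f x) (f y) ≤ Cf * dist x y ^ θ₂) :
    ∃ C : ℝ, 0 < C ∧ ∀ u : W → ℝ, Measurable u → besovNorm νW s p u ≠ ⊤ →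
      besovNorm νZ s' p (u ∘ f) ≤ ENNReal.ofReal C * besovNorm νW s p u := by
  obtain ⟨CZ, hCZ1, hCZ⟩ := hAZ
  obtain ⟨CW, hCW1, hCW⟩ := hAW
  have hp0 : 0 < p := by linarith
  have hCZ0 : 0 < CZ := by linarith
  have hCW0 : 0 < CW := by linarith
  have hCf0 : 0 < Cf := by linarith
  have hdiamZ : 0 < ediam (univ : Set Z) := by
    refine pos_iff_ne_zero.2 fun h0 => ?_
    change ENNReal.ofReal r < 2 * ediam (univ : Set Z) at hr'
    simp [h0] at hr'
  obtain ⟨z₁, -, z₂, -, hz⟩ := ediam_pos_iff.1 hdiamZ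
  have hw : f z₁ ≠ f z₂ := f.injective.ne hz
  have hdiamW : 0 < ediam (univ : Set W) :=
    ediam_pos_iff.2 ⟨f z₁, mem_univ _, f z₂, mem_univ _, hw⟩
  have hZup : ∀ (z : Z) (t : ℝ), 0 < t → νZ (ball z t) ≤ ENNReal.ofReal (CZ * t ^ QZ) :=
    fun z t ht => measure_ball_le_of_ahlfors hQZ hCZ1 hdiamZ (fun z r h h' => (hCZ z r h h').2) z ht
  have hWup : ∀ (w : W) (t : ℝ), 0 < t → νW (ball w t) ≤ ENNReal.ofReal (CW * t ^ QW) :=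
    fun w t ht => measure_ball_le_of_ahlfors hQW hCW1 hdiamW (fun z r h h' => (hCW z r h h').2) w ht
  have hZlow : ∀ x y : Z, x ≠ y →
      ENNReal.ofReal (CZ⁻¹ * dist x y ^ QZ) ≤ νZ (ball x (dist x y)) := fun x y hxy =>
    (hCZ x _ (dist_pos.2 hxy) (ofReal_dist_lt_two_mul_ediam hxy)).1
  obtain ⟨ρ₀, hρ₀, hρ₀1, hWlow⟩ : ∃ ρ₀ : ℝ, 0 < ρ₀ ∧ ρ₀ ≤ 1 ∧ ∀ (w : W) (t : ℝ), 0 < t →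
      t ≤ ρ₀ → ENNReal.ofReal (CW⁻¹ * t ^ QW) ≤ νW (ball w t) :=
    ⟨min (dist (f z₁) (f z₂)) 1, lt_min (dist_pos.2 hw) one_pos, min_le_right _ _,
      fun w t ht hle => (hCW w t ht ((ENNReal.ofReal_le_ofReal
        (hle.trans (min_le_left _ _))).trans_lt (ofReal_dist_lt_two_mul_ediam hw))).1⟩
  have : SigmaFinite νZ := sigmaFinite_of_measure_ball_ne_top fun z t ht =>
    ((hZup z t ht).trans_lt ENNReal.ofReal_lt_top).ne
  have : SigmaFinite νW := sigmaFinite_of_measure_ball_ne_top fun w t ht =>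
    ((hWup w t ht).trans_lt ENNReal.ofReal_lt_top).ne
  have : SecondCountableTopology W := by
    refine secondCountableTopology_of_measure_closedBall_pos (ν := νW) fun w t ht => ?_
    have hm : 0 < min t ρ₀ := lt_min ht hρ₀
    calc 0 < ENNReal.ofReal (CW⁻¹ * min t ρ₀ ^ QW) := ENNReal.ofReal_pos.2 (by positivity)
      _ ≤ νW (ball w (min t ρ₀)) := hWlow w _ hm (min_le_right _ _)
      _ ≤ νW (closedBall w t) := measure_mono
          ((ball_subset_ball (min_le_left _ _)).trans ball_subset_closedBall)
  have : SecondCountableTopology Z := f.secondCountableTopology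
  have : IsLocallyFiniteMeasure νW := ⟨fun w => ⟨ball w 1, ball_mem_nhds w one_pos,
    (hWup w 1 one_pos).trans_lt ENNReal.ofReal_lt_top⟩⟩
  set M := CZ * 2 ^ QZ * (5 * Cf) ^ (QZ / θ₁) * CW
  have hM0 : 0 < M := by positivity
  have hmap : νZ.map f.toMeasurableEquiv ≤ ENNReal.ofReal M • νW := by
    refine map_le_smul_of_local f (ε := r / 2) (by positivity) fun z E hE => ?_
    refine measure_le_mul_measure_image_of_holder_lower hθ₁ hQ hCZ0 hCW0 hCf0 hρ₀ hρ₀1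
      hZup hWlow f E fun x hx y hy => (hf x y ?_).1
    have h1 := mem_ball.1 (hE hx)
    have h2 := mem_ball.1 (hE hy)
    linarith [dist_triangle_right x y z]
  obtain ⟨K, hK, hKden⟩ := exists_denominator_le (s := s) (s' := s') (p := p) hCZ0 hCW0 hCf0 hr
    hQW hs hp0 (by
      have h1 := mul_le_mul_of_nonneg_right hss' hp0.le
      rw [add_mul, div_mul_cancel₀ _ hp0.ne'] at h1
      linarith) hZlow hWup f.injective fun x y h => (hf x y h).2
  obtain ⟨G, hG, hGker⟩ := exists_lintegral_farKernel_le (β := s' * p) hQZ hCZ0 hr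
    (by positivity) hZup
  set N : ℝ := 2 ^ (p - 1) * CZ
  have hN0 : 0 < N := by positivity
  refine ⟨M ^ (1 / p) + (K * (M * M)) ^ (1 / p) + (N * (2 * G * M)) ^ (1 / p), by positivity,
    fun u hu _ => ?_⟩
  have hLp : ∫⁻ z, ‖(u ∘ f) z‖ₑ ^ p ∂νZ ≤ ENNReal.ofReal M * ∫⁻ w, ‖u w‖ₑ ^ p ∂νW :=
    lintegral_comp_le_of_map_le f.toMeasurableEquiv hmap fun w => ‖u w‖ₑ ^ p
  refine besovNorm_le_of_lintegral_le hp (by positivity) (by positivity) hM0 hLp ?_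
  set F : W → W → ℝ≥0∞ := fun w w' => ENNReal.ofReal (|u w - u w'| ^ p) /
    (ENNReal.ofReal (dist w w' ^ (s * p)) * νW (ball w (dist w w')))
  set k : Z → Z → ℝ≥0∞ := farKernel r (s' * p + QZ)
  set h : Z → ℝ≥0∞ := fun z => ‖u (f z)‖ₑ ^ p
  have hkm : Measurable (Function.uncurry k) := measurable_uncurry_farKernel _ _
  have hhm : Measurable h := (hu.comp f.continuous.measurable).enorm.pow_const p
  have hfarm : Measurable (Function.uncurry fun x y => ENNReal.ofReal N * ((h x + h y) * k x y)) :=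
    (((hhm.comp measurable_fst).add (hhm.comp measurable_snd)).mul hkm).const_mul _
  have hpt : ∀ x y : Z, ENNReal.ofReal (|(u ∘ f) x - (u ∘ f) y| ^ p) /
      (ENNReal.ofReal (dist x y ^ (s' * p)) * νZ (ball x (dist x y))) ≤
      ENNReal.ofReal K * F (f x) (f y) + ENNReal.ofReal N * ((h x + h y) * k x y) := by
    intro x y
    rcases eq_or_ne x y with rfl | hxy
    · simp [Real.zero_rpow hp0.ne']
    rcases lt_or_ge (dist x y) r with hlt | hge
    · exact (div_le_mul_div_of_le_mul (ENNReal.ofReal_pos.2 hK).ne' ENNReal.ofReal_ne_top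
        (hKden x y hxy hlt)).trans le_self_add
    · exact (besov_integrand_far_le hCZ0 hr hp (u ∘ f) (hZlow x y hxy) hge).trans le_add_self
  have hnear : ∫⁻ x, ∫⁻ y, ENNReal.ofReal K * F (f x) (f y) ∂νZ ∂νZ ≤
      ENNReal.ofReal (K * (M * M)) * besovDouble νW s p u := by
    simp_rw [lintegral_const_mul' _ _ ENNReal.ofReal_ne_top]
    rw [ENNReal.ofReal_mul hK.le, ENNReal.ofReal_mul hM0.le, mul_assoc, mul_assoc]
    gcongr
    calc ∫⁻ x, ∫⁻ y, F (f x) (f y) ∂νZ ∂νZ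
        ≤ ∫⁻ x, ENNReal.ofReal M * ∫⁻ w', F (f x) w' ∂νW ∂νZ := lintegral_mono fun x =>
          lintegral_comp_le_of_map_le f.toMeasurableEquiv hmap (F (f x))
      _ = ENNReal.ofReal M * ∫⁻ x, ∫⁻ w', F (f x) w' ∂νW ∂νZ :=
          lintegral_const_mul' _ _ ENNReal.ofReal_ne_top
      _ ≤ ENNReal.ofReal M * (ENNReal.ofReal M * ∫⁻ w, ∫⁻ w', F w w' ∂νW ∂νW) := by
          gcongr
          exact lintegral_comp_le_of_map_le f.toMeasurableEquiv hmap fun w => ∫⁻ w', F w w' ∂νW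
  have hfar : ∫⁻ x, ∫⁻ y, ENNReal.ofReal N * ((h x + h y) * k x y) ∂νZ ∂νZ ≤
      ENNReal.ofReal (N * (2 * G * M)) * ∫⁻ w, ‖u w‖ₑ ^ p ∂νW := by
    simp_rw [lintegral_const_mul' _ _ ENNReal.ofReal_ne_top]
    have hconst : ENNReal.ofReal (2 * G * M) = 2 * ENNReal.ofReal G * ENNReal.ofReal M := by
      rw [ENNReal.ofReal_mul (by positivity), ENNReal.ofReal_mul zero_le_two, ENNReal.ofReal_ofNat]
    rw [ENNReal.ofReal_mul hN0.le, hconst, mul_assoc, mul_assoc (2 * ENNReal.ofReal G)]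
    gcongr
    exact (lintegral_lintegral_add_mul_le hkm (farKernel_comm _ _) hGker hhm).trans
      (mul_le_mul_right hLp _)
  calc besovDouble νZ s' p (u ∘ f)
      ≤ ∫⁻ x, ∫⁻ y, (ENNReal.ofReal K * F (f x) (f y) +
          ENNReal.ofReal N * ((h x + h y) * k x y)) ∂νZ ∂νZ :=
        lintegral_mono fun x => lintegral_mono fun y => hpt x y
    _ = ∫⁻ x, ∫⁻ y, ENNReal.ofReal K * F (f x) (f y) ∂νZ ∂νZ +
          ∫⁻ x, ∫⁻ y, ENNReal.ofReal N * ((h x + h y) * k x y) ∂νZ ∂νZ := by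
        rw [← lintegral_add_right _ hfarm.lintegral_prod_right]
        exact lintegral_congr fun x => lintegral_add_right _ hfarm.of_uncurry_left
    _ ≤ _ := add_le_add hnear hfar
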